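/- arXiv:2310.11203 — 2 statements merged into one kernel-verified Lean document; each statement's English description precedes it below -/
import Mathlib

section
/- Fix a probability measure D on Z, an integer m ≥ 1, a (data-free) prior probability measure P on H, and δ ∈ (0,1). With probability at least 1−δ over the draw of an i.i.d. sample S = (z_1,…,z_m) ~ D^⊗m, simultaneously for every probability measure Q on H, kl(R̂_S(Q), R_D(Q)) ≤ (KL(Q‖P) + ln(2√m/δ)) / m (McAllester–Maurer PAC-Bayes bound). -/
open MeasureTheory ENNReal

/-- Binary Kullback–Leibler divergence `kl(q,p)` for `q, p ∈ [0,1]`, with the conventions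
`0 · ln 0 = 0` and `kl(q,p) = ∞` when `p ∈ {0,1}` and `q ≠ p`. -/
noncomputable def klBin (q p : ℝ) : ℝ≥0∞ :=
  if (p = 0 ∨ p = 1) ∧ q ≠ p then ∞
  else ENNReal.ofReal (q * Real.log (q / p) + (1 - q) * Real.log ((1 - q) / (1 - p)))

open Classical in
/-- Kullback–Leibler divergence between measures, `+∞` if `Q` is not absolutely
continuous with respect to `P` (or if the log-likelihood ratio is not integrable,
in which case the divergence between probability measures is indeed infinite). -/
noncomputable def klDiv' {α : Type*} [MeasurableSpace α] (Q P : Measure α) : ℝ≥0∞ :=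
  if Q ≪ P ∧ Integrable (fun x => Real.log (Q.rnDeriv P x).toReal) Q
  then ENNReal.ofReal (∫ x, Real.log (Q.rnDeriv P x).toReal ∂Q)
  else ∞

/-- Population risk of a hypothesis `h`. -/
noncomputable def riskD {H Z : Type*} [MeasurableSpace Z] (ℓ : H → Z → ℝ)
    (D : Measure Z) (h : H) : ℝ := ∫ z, ℓ h z ∂D

/-- Empirical risk of a hypothesis `h` on the sample `S`. -/
noncomputable def riskS {H Z : Type*} (ℓ : H → Z → ℝ) {m : ℕ} (S : Fin m → Z) (h : H) : ℝ :=
  (1 / (m : ℝ)) * ∑ j, ℓ h (S j)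

/-- Population risk of a distribution `Q` over hypotheses. -/
noncomputable def riskDQ {H Z : Type*} [MeasurableSpace H] [MeasurableSpace Z]
    (ℓ : H → Z → ℝ) (D : Measure Z) (Q : Measure H) : ℝ := ∫ h, riskD ℓ D h ∂Q

/-- Empirical risk of a distribution `Q` over hypotheses on the sample `S`. -/
noncomputable def riskSQ {H Z : Type*} [MeasurableSpace H] (ℓ : H → Z → ℝ) {m : ℕ}
    (S : Fin m → Z) (Q : Measure H) : ℝ := ∫ h, riskS ℓ S h ∂Q

theorem choose_mul_choose_sub_comm (n k i : ℕ) :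
    n.choose k * (n - k).choose i = n.choose i * (n - i).choose k := by
  have h₁ := Nat.choose_mul (n := n) (Nat.le_add_left k i)
  have h₂ := Nat.choose_mul (n := n) (Nat.le_add_right i k)
  rw [Nat.add_sub_cancel] at h₁
  rw [Nat.add_sub_cancel_left] at h₂
  rw [← h₁, ← h₂, Nat.choose_symm_add]

theorem sum_neg_one_pow_mul_choose_mul_pow (n : ℕ) :
    ∑ k ∈ Finset.range (n + 1), (-1 : ℝ) ^ (n - k) * n.choose k * (k : ℝ) ^ n = n.factorial := by
  have h := congrFun (fwdDiff_iter_eq_factorial (R := ℝ) (n := n)) 0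
  rw [fwdDiff_iter_eq_sum_shift] at h
  simpa using h

/-- A special case of Cauchy's form of the Abel binomial identity. -/
theorem sum_choose_mul_pow_mul_pow (n : ℕ) :
    ∑ k ∈ Finset.range (n + 1), (n.choose k : ℝ) * (k : ℝ) ^ k * ((n : ℝ) - k) ^ (n - k) =
      ∑ j ∈ Finset.range (n + 1), (n.descFactorial j : ℝ) * (n : ℝ) ^ (n - j) := by
  have hexp : ∀ k ∈ Finset.range (n + 1),
      (n.choose k : ℝ) * (k : ℝ) ^ k * ((n : ℝ) - k) ^ (n - k) =
        ∑ i ∈ Finset.range (n - k + 1), (n.choose i : ℝ) * (n : ℝ) ^ i *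
          ((-1) ^ (n - i - k) * (n - i).choose k * (k : ℝ) ^ (n - i)) := by
    intro k hk
    rw [sub_eq_add_neg, add_pow, Finset.mul_sum]
    refine Finset.sum_congr rfl fun i hi => ?_
    have hk' := Finset.mem_range.1 hk
    have hi' := Finset.mem_range.1 hi
    have hc : (n.choose k : ℝ) * (n - k).choose i = n.choose i * (n - i).choose k := by
      exact_mod_cast choose_mul_choose_sub_comm n k i
    have he : n - i = k + (n - k - i) := by omega
    have he' : n - i - k = n - k - i := by omega
    rw [he', neg_pow, show (k : ℝ) ^ (n - i) = k ^ k * k ^ (n - k - i) by rw [← pow_add, ← he]]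
    linear_combination (k : ℝ) ^ k * n ^ i * (-1) ^ (n - k - i) * k ^ (n - k - i) * hc
  rw [Finset.sum_congr rfl hexp,
    Finset.sum_comm' (t' := Finset.range (n + 1)) (s' := fun i => Finset.range (n - i + 1))
      (by intro x y; simp only [Finset.mem_range]; omega)]
  simp_rw [← Finset.mul_sum, sum_neg_one_pow_mul_choose_mul_pow]
  rw [← Finset.sum_range_reflect]
  refine Finset.sum_congr rfl fun j hj => ?_
  have hj' : j ≤ n := by have := Finset.mem_range.1 hj; omega
  rw [show n + 1 - 1 - j = n - j by omega, Nat.sub_sub_self hj', Nat.choose_symm hj',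
    Nat.descFactorial_eq_factorial_mul_choose]
  push_cast
  ring

theorem sq_sum_range_le (a : ℕ → ℝ) (h0 : ∀ j, 0 ≤ a j) (h1 : ∀ j, a j ≤ 1) (n : ℕ) :
    (∑ j ∈ Finset.range n, a j) ^ 2 ≤ ∑ j ∈ Finset.range n, (2 * (j : ℝ) + 1) * a j := by
  induction n with
  | zero => simp
  | succ n ih =>
    rw [Finset.sum_range_succ, Finset.sum_range_succ]
    have hs : ∑ j ∈ Finset.range n, a j ≤ n := by
      simpa using Finset.sum_le_card_nsmul (Finset.range n) a 1 fun j _ => h1 j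
    nlinarith [h0 n, h1 n, mul_le_mul_of_nonneg_left hs (h0 n),
      mul_le_mul_of_nonneg_left (h1 n) (h0 n)]

theorem sum_descFactorial_div_pow_le (m : ℕ) (hm : 1 ≤ m) :
    ∑ j ∈ Finset.range (m + 1), (m.descFactorial j : ℝ) / (m : ℝ) ^ j ≤ 2 * √m := by
  have hm' : (1 : ℝ) ≤ m := by exact_mod_cast hm
  have hm0 : (m : ℝ) ≠ 0 := by positivity
  set a : ℕ → ℝ := fun j => (m.descFactorial j : ℝ) / (m : ℝ) ^ j with ha
  have h0 : ∀ j, 0 ≤ a j := fun j => by positivity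
  have h1 : ∀ j, a j ≤ 1 := fun j => by
    refine div_le_one_of_le₀ ?_ (by positivity)
    exact_mod_cast Nat.descFactorial_le_pow m j
  have hstep : ∀ j ∈ Finset.range (m + 1), (j : ℝ) * a j = m * (a j - a (j + 1)) := by
    intro j hj
    have hj' : j ≤ m := by have := Finset.mem_range.1 hj; omega
    simp only [ha, Nat.descFactorial_succ, Nat.cast_mul, Nat.cast_sub hj', pow_succ]
    field_simp
    ring
  have hmean : ∑ j ∈ Finset.range (m + 1), (j : ℝ) * a j = m := by
    rw [Finset.sum_congr rfl hstep, ← Finset.mul_sum, Finset.sum_range_sub']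
    simp [ha]
  have hsq := sq_sum_range_le a h0 h1 (m + 1)
  have hsum : ∑ j ∈ Finset.range (m + 1), (2 * (j : ℝ) + 1) * a j =
      2 * m + ∑ j ∈ Finset.range (m + 1), a j := by
    rw [← hmean, Finset.mul_sum, ← Finset.sum_add_distrib]
    exact Finset.sum_congr rfl fun j _ => by ring
  rw [hsum] at hsq
  have hr : √(m : ℝ) ^ 2 = m := Real.sq_sqrt (by positivity)
  have hr1 : 1 ≤ √(m : ℝ) := Real.one_le_sqrt.2 hm'
  by_contra! hlt
  change 2 * √(m : ℝ) < ∑ j ∈ Finset.range (m + 1), a j at hlt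
  nlinarith

theorem sum_choose_mul_div_pow_le (m : ℕ) (hm : 1 ≤ m) :
    ∑ k ∈ Finset.range (m + 1),
      (m.choose k : ℝ) * (((k : ℝ) / m) ^ k * (1 - (k : ℝ) / m) ^ (m - k)) ≤ 2 * √m := by
  have hm0 : (m : ℝ) ≠ 0 := by positivity
  refine le_of_eq_of_le ?_ (sum_descFactorial_div_pow_le m hm)
  have h := congrArg (· / (m : ℝ) ^ m) (sum_choose_mul_pow_mul_pow m)
  simp only [Finset.sum_div] at h
  convert h using 1
  · refine Finset.sum_congr rfl fun k hk => ?_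
    have hk' : k ≤ m := by have := Finset.mem_range.1 hk; omega
    rw [show 1 - (k : ℝ) / m = (m - k) / m by field_simp, div_pow, div_pow,
      show (m : ℝ) ^ m = m ^ k * m ^ (m - k) by rw [← pow_add, Nat.add_sub_cancel' hk']]
    field_simp
  · refine Finset.sum_congr rfl fun j hj => ?_
    have hj' : j ≤ m := by have := Finset.mem_range.1 hj; omega
    rw [show (m : ℝ) ^ m = m ^ j * m ^ (m - j) by rw [← pow_add, Nat.add_sub_cancel' hj']]
    field_simp

/-- The real-valued expression underlying `klBin`. -/
noncomputable def klReal (q p : ℝ) : ℝ :=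
  q * Real.log (q / p) + (1 - q) * Real.log ((1 - q) / (1 - p))

/-- The probability that independent Bernoulli variables with parameters `x i`, `i ∈ t`,
take the value one exactly on `s`. -/
noncomputable def bernoulliWeight {ι : Type*} [DecidableEq ι] (x : ι → ℝ) (t s : Finset ι) : ℝ :=
  ∏ i ∈ t, if i ∈ s then x i else 1 - x i

section BernoulliWeight

variable {ι : Type*} [DecidableEq ι] (x : ι → ℝ)

theorem sum_bernoulliWeight_insert {a : ι} {t : Finset ι} (ha : a ∉ t) (f : ℕ → ℝ) :
    ∑ s ∈ (insert a t).powerset, bernoulliWeight x (insert a t) s * f s.card =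
      (1 - x a) * ∑ s ∈ t.powerset, bernoulliWeight x t s * f s.card +
        x a * ∑ s ∈ t.powerset, bernoulliWeight x t s * f (s.card + 1) := by
  rw [Finset.sum_powerset_insert ha, Finset.mul_sum, Finset.mul_sum]
  congr 1
  · refine Finset.sum_congr rfl fun s hs => ?_
    have has : a ∉ s := fun h => ha (Finset.mem_powerset.1 hs h)
    rw [bernoulliWeight, Finset.prod_insert ha, if_neg has, bernoulliWeight, mul_assoc]
  · refine Finset.sum_congr rfl fun s hs => ?_
    have has : a ∉ s := fun h => ha (Finset.mem_powerset.1 hs h)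
    rw [bernoulliWeight, Finset.prod_insert ha, if_pos (Finset.mem_insert_self a s),
      Finset.card_insert_of_notMem has, bernoulliWeight, mul_assoc]
    congr 2
    refine Finset.prod_congr rfl fun i hi => ?_
    have hia : i ≠ a := fun h => ha (h ▸ hi)
    simp [Finset.mem_insert, hia]

theorem sum_bernoulliWeight (t : Finset ι) :
    ∑ s ∈ t.powerset, bernoulliWeight x t s = 1 := by
  induction t using Finset.induction_on with
  | empty => simp [bernoulliWeight]
  | insert a t ha ih =>
    have h := sum_bernoulliWeight_insert x ha fun _ => 1
    simp only [mul_one] at h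
    rw [h, ih]
    ring

theorem sum_bernoulliWeight_mul_card (t : Finset ι) :
    ∑ s ∈ t.powerset, bernoulliWeight x t s * s.card = ∑ i ∈ t, x i := by
  induction t using Finset.induction_on with
  | empty => simp [bernoulliWeight]
  | insert a t ha ih =>
    rw [sum_bernoulliWeight_insert x ha fun n => (n : ℝ), Finset.sum_insert ha]
    simp only [Nat.cast_add, Nat.cast_one, mul_add, mul_one, Finset.sum_add_distrib, ih,
      sum_bernoulliWeight]
    ring

theorem bernoulliWeight_nonneg {x : ι → ℝ} (hx : ∀ i, x i ∈ Set.Icc (0 : ℝ) 1) (t s : Finset ι) :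
    0 ≤ bernoulliWeight x t s := by
  refine Finset.prod_nonneg fun i _ => ?_
  have := hx i
  split_ifs
  · exact this.1
  · linarith [this.2]

end BernoulliWeight

/-- A convex function of the mean of `[0,1]`-valued numbers is dominated by its expectation
under the independent Bernoulli rounding. -/
theorem ConvexOn.map_mean_le_sum_bernoulliWeight {f : ℝ → ℝ} (hf : ConvexOn ℝ (Set.Icc 0 1) f)
    {m : ℕ} (hm : 1 ≤ m) {x : Fin m → ℝ} (hx : ∀ i, x i ∈ Set.Icc (0 : ℝ) 1) :
    f (1 / (m : ℝ) * ∑ i, x i) ≤ ∑ s ∈ (Finset.univ : Finset (Fin m)).powerset,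
      bernoulliWeight x Finset.univ s * f ((s.card : ℝ) / m) := by
  have hm0 : (0 : ℝ) < m := by exact_mod_cast hm
  have h := hf.map_sum_le (t := (Finset.univ : Finset (Fin m)).powerset)
    (w := fun s => bernoulliWeight x Finset.univ s) (p := fun s => (s.card : ℝ) / m)
    (fun s _ => bernoulliWeight_nonneg hx _ s) (sum_bernoulliWeight x _) (fun s _ => by
      refine ⟨by positivity, div_le_one_of_le₀ ?_ hm0.le⟩
      exact_mod_cast (Finset.card_le_univ s).trans_eq (Fintype.card_fin m))
  simp only [smul_eq_mul] at h
  refine le_of_eq_of_le (congrArg f ?_) h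
  rw [← sum_bernoulliWeight_mul_card, Finset.mul_sum]
  exact Finset.sum_congr rfl fun s _ => by ring

theorem mul_log_div_eq (x : ℝ) {p : ℝ} (hp : p ≠ 0) :
    x * Real.log (x / p) = x * Real.log x - x * Real.log p := by
  rcases eq_or_ne x 0 with rfl | hx
  · simp
  · rw [Real.log_div hx hp, mul_sub]

theorem convexOn_mul_log_div {p : ℝ} (hp : p ≠ 0) :
    ConvexOn ℝ (Set.Ici 0) fun x => x * Real.log (x / p) := by
  simp_rw [mul_log_div_eq _ hp]
  refine Real.convexOn_mul_log.sub ⟨convex_Ici 0, fun x _ y _ a b _ _ _ => ?_⟩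
  simp only [smul_eq_mul]
  exact le_of_eq (by ring)

theorem convexOn_klReal {p : ℝ} (hp : p ∈ Set.Ioo (0 : ℝ) 1) :
    ConvexOn ℝ (Set.Icc 0 1) fun q => klReal q p := by
  refine ConvexOn.add ((convexOn_mul_log_div hp.1.ne').subset Set.Icc_subset_Ici_self
    (convex_Icc 0 1)) ⟨convex_Icc 0 1, fun x hx y hy a b ha hb hab => ?_⟩
  have h := (convexOn_mul_log_div (sub_pos.2 hp.2).ne').2 (x := 1 - x) (y := 1 - y)
    (sub_nonneg.2 hx.2) (sub_nonneg.2 hy.2) ha hb hab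
  simp only [smul_eq_mul] at h ⊢
  rwa [show a * (1 - x) + b * (1 - y) = 1 - (a * x + b * y) by linear_combination hab] at h

theorem convexOn_exp_mul_klReal {p : ℝ} (hp : p ∈ Set.Ioo (0 : ℝ) 1) (m : ℕ) :
    ConvexOn ℝ (Set.Icc 0 1) fun q => Real.exp (m * klReal q p) := by
  have h := (convexOn_klReal hp).smul (Nat.cast_nonneg (α := ℝ) m)
  refine ⟨convex_Icc 0 1, fun x hx y hy a b ha hb hab => ?_⟩
  refine (Real.exp_le_exp.2 (h.2 hx hy ha hb hab)).trans ?_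
  exact convexOn_exp.2 (Set.mem_univ _) (Set.mem_univ _) ha hb hab

theorem pow_mul_exp_mul_log_div {p q c : ℝ} {k : ℕ} (hp : 0 < p) (hq : 0 ≤ q) (hk : c * q = k) :
    p ^ k * Real.exp (c * (q * Real.log (q / p))) = q ^ k := by
  rw [← mul_assoc, hk]
  rcases hq.eq_or_lt with rfl | hq
  · have : k = 0 := by
      rw [mul_zero] at hk
      exact_mod_cast hk.symm
    simp [this]
  · rw [← Real.log_pow, Real.exp_log (by positivity), div_pow]
    field_simp

theorem pow_mul_pow_mul_exp_klReal {p : ℝ} (hp : p ∈ Set.Ioo (0 : ℝ) 1) {m k : ℕ} (hm : 1 ≤ m)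
    (hk : k ≤ m) :
    p ^ k * (1 - p) ^ (m - k) * Real.exp (m * klReal ((k : ℝ) / m) p) =
      ((k : ℝ) / m) ^ k * (1 - (k : ℝ) / m) ^ (m - k) := by
  have hm0 : (0 : ℝ) < m := by exact_mod_cast hm
  have hkm : (k : ℝ) / m ≤ 1 := div_le_one_of_le₀ (by exact_mod_cast hk) hm0.le
  rw [klReal, mul_add, Real.exp_add, ← pow_mul_exp_mul_log_div (c := m) (k := k) hp.1
    (q := (k : ℝ) / m) (by positivity) (by field_simp),
    ← pow_mul_exp_mul_log_div (c := m) (k := m - k) (sub_pos.2 hp.2)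
    (q := 1 - (k : ℝ) / m) (sub_nonneg.2 hkm) (by rw [Nat.cast_sub hk]; field_simp)]
  ring

theorem integral_bernoulliWeight {Z : Type*} [MeasurableSpace Z] (D : Measure Z)
    [IsProbabilityMeasure D] {g : Z → ℝ} (hg : Integrable g D) {m : ℕ} (s : Finset (Fin m)) :
    ∫ S, bernoulliWeight (fun i => g (S i)) Finset.univ s ∂(Measure.pi fun _ : Fin m => D) =
      (∫ z, g z ∂D) ^ s.card * (1 - ∫ z, g z ∂D) ^ (m - s.card) := by
  have h := integral_fintype_prod_eq_prod (μ := fun _ : Fin m => D)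
    (fun i z => if i ∈ s then g z else 1 - g z)
  simp only [bernoulliWeight]
  rw [h]
  have h' : ∀ i, ∫ z, (if i ∈ s then g z else 1 - g z) ∂D =
      if i ∈ s then ∫ z, g z ∂D else 1 - ∫ z, g z ∂D := by
    intro i
    split_ifs
    · rfl
    · rw [integral_sub (integrable_const _) hg]
      simp
  simp_rw [h', Finset.prod_ite, Finset.prod_const]
  congr 2
  · simp
  · rw [Finset.filter_not, Finset.filter_univ_mem, ← Finset.compl_eq_univ_sdiff,
      Finset.card_compl, Fintype.card_fin]

theorem lintegral_exp_klReal_le {Z : Type*} [MeasurableSpace Z] (D : Measure Z)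
    [IsProbabilityMeasure D] {g : Z → ℝ} (hg : Measurable g) (hg01 : ∀ z, g z ∈ Set.Icc (0 : ℝ) 1)
    {m : ℕ} (hm : 1 ≤ m) (hp : ∫ z, g z ∂D ∈ Set.Ioo (0 : ℝ) 1) :
    ∫⁻ S, ENNReal.ofReal (Real.exp (m * klReal (1 / (m : ℝ) * ∑ j, g (S j)) (∫ z, g z ∂D)))
      ∂(Measure.pi fun _ : Fin m => D) ≤ ENNReal.ofReal (2 * √m) := by
  set p := ∫ z, g z ∂D with hpdef
  have hgint : Integrable g D := Integrable.of_mem_Icc 0 1 hg.aemeasurable (ae_of_all _ hg01)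
  set F : (Fin m → Z) → ℝ := fun S => ∑ s ∈ (Finset.univ : Finset (Fin m)).powerset,
    bernoulliWeight (fun i => g (S i)) Finset.univ s * Real.exp (m * klReal ((s.card : ℝ) / m) p)
    with hF
  have hwint : ∀ s : Finset (Fin m), Integrable
      (fun S : Fin m → Z => bernoulliWeight (fun i => g (S i)) Finset.univ s)
      (Measure.pi fun _ => D) := by
    intro s
    refine Integrable.of_mem_Icc 0 1 (Measurable.aemeasurable ?_) (ae_of_all _ fun S => ?_)
    · refine Finset.measurable_prod _ fun i _ => ?_
      split_ifs <;> fun_prop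
    · refine ⟨bernoulliWeight_nonneg (fun i => hg01 _) _ _, Finset.prod_le_one ?_ ?_⟩ <;>
      · intro i _
        have := hg01 (S i)
        split_ifs <;> linarith [this.1, this.2]
  have hint : Integrable F (Measure.pi fun _ => D) :=
    integrable_finsetSum _ fun s _ => (hwint s).mul_const _
  have hF0 : ∀ S, 0 ≤ F S := fun S => Finset.sum_nonneg fun s _ =>
    mul_nonneg (bernoulliWeight_nonneg (fun i => hg01 _) _ _) (Real.exp_pos _).le
  calc _ ≤ ∫⁻ S, ENNReal.ofReal (F S) ∂(Measure.pi fun _ : Fin m => D) :=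
        lintegral_mono fun S => ENNReal.ofReal_le_ofReal
          ((convexOn_exp_mul_klReal hp m).map_mean_le_sum_bernoulliWeight hm fun i => hg01 _)
    _ = ENNReal.ofReal (∫ S, F S ∂(Measure.pi fun _ : Fin m => D)) :=
        (ofReal_integral_eq_lintegral_ofReal hint (ae_of_all _ hF0)).symm
    _ ≤ _ := ENNReal.ofReal_le_ofReal ?_
  rw [hF, integral_finsetSum _ fun s _ => (hwint s).mul_const _]
  simp_rw [integral_mul_const, integral_bernoulliWeight D hgint, ← hpdef]
  rw [Finset.sum_powerset_apply_card
    (fun k => p ^ k * (1 - p) ^ (m - k) * Real.exp (m * klReal ((k : ℝ) / m) p)),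
    Finset.card_univ, Fintype.card_fin]
  refine le_of_eq_of_le (Finset.sum_congr rfl fun k hk => ?_) (sum_choose_mul_div_pow_le m hm)
  rw [nsmul_eq_mul, pow_mul_pow_mul_exp_klReal hp hm (by have := Finset.mem_range.1 hk; omega)]

theorem mul_log_div_tangent_le {q p a b : ℝ} (hq : 0 ≤ q) (hp : 0 ≤ p) (ha : 0 ≤ a) (hb : 0 ≤ b)
    (hpq : p = 0 → q = 0) (hba : b = 0 → a = 0) (haq : a = 0 → q = 0) :
    q * Real.log (a / b) + q - p * (a / b) ≤ q * Real.log (q / p) := by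
  rcases hq.eq_or_lt with rfl | hq
  · have : 0 ≤ p * (a / b) := by positivity
    simpa using this
  · have hp : 0 < p := hp.lt_of_ne fun h => hq.ne' (hpq h.symm)
    have ha : 0 < a := ha.lt_of_ne fun h => hq.ne' (haq h.symm)
    have hb : 0 < b := hb.lt_of_ne fun h => ha.ne' (hba h.symm)
    have h := Real.log_le_sub_one_of_pos (x := p * (a / b) / q) (by positivity)
    rw [Real.log_div (by positivity) hq.ne', Real.log_mul hp.ne' (by positivity)] at h
    rw [Real.log_div hq.ne' hp.ne']
    have h' := mul_le_mul_of_nonneg_left h hq.le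
    have hc : q * (p * (a / b) / q - 1) = p * (a / b) - q := by field_simp
    rw [hc] at h'
    linarith

theorem klReal_nonneg {q p : ℝ} (hq : q ∈ Set.Icc (0 : ℝ) 1) (hp : p ∈ Set.Icc (0 : ℝ) 1)
    (h0 : p = 0 → q = 0) (h1 : p = 1 → q = 1) : 0 ≤ klReal q p := by
  have hl := mul_log_div_tangent_le (a := 1) (b := 1) hq.1 hp.1 zero_le_one zero_le_one h0
    (by simp) (by simp)
  have hr := mul_log_div_tangent_le (a := 1) (b := 1) (sub_nonneg.2 hq.2) (sub_nonneg.2 hp.2)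
    zero_le_one zero_le_one (fun h => by rw [h1 (by linarith), sub_self]) (by simp) (by simp)
  simp only [div_one, Real.log_one, mul_zero, mul_one] at hl hr
  rw [klReal]
  linarith

/-- Jensen's inequality for the jointly convex binary relative entropy. -/
theorem klBin_integral_le {H : Type*} [MeasurableSpace H] (Q : Measure H) [IsProbabilityMeasure Q]
    {q p : H → ℝ} (hqm : AEMeasurable q Q) (hpm : AEMeasurable p Q)
    (hq : ∀ h, q h ∈ Set.Icc (0 : ℝ) 1) (hp : ∀ h, p h ∈ Set.Icc (0 : ℝ) 1)
    (h0 : ∀ᵐ h ∂Q, p h = 0 → q h = 0) (h1 : ∀ᵐ h ∂Q, p h = 1 → q h = 1)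
    (hint : Integrable (fun h => klReal (q h) (p h)) Q) :
    klBin (∫ h, q h ∂Q) (∫ h, p h ∂Q) ≤ ENNReal.ofReal (∫ h, klReal (q h) (p h) ∂Q) := by
  have hqi : Integrable q Q := Integrable.of_mem_Icc 0 1 hqm (ae_of_all _ hq)
  have hpi : Integrable p Q := Integrable.of_mem_Icc 0 1 hpm (ae_of_all _ hp)
  have hzero : ∀ {f : H → ℝ}, (∀ h, 0 ≤ f h) → Integrable f Q → ∫ h, f h ∂Q = 0 →
      ∀ᵐ h ∂Q, f h = 0 := fun hf hfi h => (integral_eq_zero_iff_of_nonneg hf hfi).1 h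
  have hcompl : ∀ {f : H → ℝ}, Integrable f Q → ∫ h, (1 - f h) ∂Q = 1 - ∫ h, f h ∂Q := by
    intro f hf
    rw [integral_sub (integrable_const _) hf]
    simp
  set a := ∫ h, q h ∂Q with ha
  set b := ∫ h, p h ∂Q with hb
  have ha0 : 0 ≤ a := integral_nonneg fun h => (hq h).1
  have hb0 : 0 ≤ b := integral_nonneg fun h => (hp h).1
  have ha1 : 0 ≤ 1 - a := by
    rw [ha, ← hcompl hqi]
    exact integral_nonneg fun h => sub_nonneg.2 (hq h).2
  have hb1 : 0 ≤ 1 - b := by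
    rw [hb, ← hcompl hpi]
    exact integral_nonneg fun h => sub_nonneg.2 (hp h).2
  have haq0 : ∀ᵐ h ∂Q, a = 0 → q h = 0 := by
    by_cases h : a = 0
    · filter_upwards [hzero (fun h => (hq h).1) hqi h] with x hx _ using hx
    · exact ae_of_all _ fun x hx => absurd hx h
  have haq1 : ∀ᵐ h ∂Q, 1 - a = 0 → 1 - q h = 0 := by
    by_cases h : 1 - a = 0
    · filter_upwards [hzero (fun h => sub_nonneg.2 (hq h).2) ((integrable_const _).sub hqi)
        ((hcompl hqi).trans h)] with x hx _ using hx
    · exact ae_of_all _ fun x hx => absurd hx h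
  have hba0 : b = 0 → a = 0 := fun h => by
    refine integral_eq_zero_of_ae ?_
    filter_upwards [h0, hzero (fun h => (hp h).1) hpi h] with x hx hx' using hx hx'
  have hba1 : 1 - b = 0 → 1 - a = 0 := fun h => by
    rw [ha, ← hcompl hqi]
    refine integral_eq_zero_of_ae ?_
    filter_upwards [h1, hzero (fun h => sub_nonneg.2 (hp h).2) ((integrable_const _).sub hpi)
        ((hcompl hpi).trans h)] with x hx hx'
    simp [hx (by linarith)]
  have hbad : ¬((b = 0 ∨ b = 1) ∧ a ≠ b) := by
    rintro ⟨h | h, hne⟩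
    · exact hne ((hba0 h).trans h.symm)
    · have := hba1 (by linarith)
      exact hne (by linarith)
  rw [klBin, if_neg hbad]
  refine ENNReal.ofReal_le_ofReal ?_
  set L := Real.log (a / b)
  set M := Real.log ((1 - a) / (1 - b))
  set u := a / b with hu
  set v := (1 - a) / (1 - b) with hv
  have hbu : b * u = a := by
    by_cases h : b = 0
    · rw [h, hba0 h, zero_mul]
    · rw [hu]; field_simp
  have hbv : (1 - b) * v = 1 - a := by
    by_cases h : 1 - b = 0
    · rw [h, hba1 h, zero_mul]
    · rw [hv]; field_simp
  have hle : ∀ᵐ h ∂Q, q h * (L - M) - p h * (u - v) + (M + 1 - v) ≤ klReal (q h) (p h) := by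
    filter_upwards [h0, h1, haq0, haq1] with h hh0 hh1 hha0 hha1
    have hl := mul_log_div_tangent_le (hq h).1 (hp h).1 ha0 hb0 hh0 hba0 hha0
    have hr := mul_log_div_tangent_le (sub_nonneg.2 (hq h).2) (sub_nonneg.2 (hp h).2) ha1 hb1
      (fun h' => by rw [hh1 (by linarith), sub_self]) hba1 hha1
    rw [klReal]
    linarith
  have hi₁ : Integrable (fun h => q h * (L - M) - p h * (u - v)) Q :=
    (hqi.mul_const _).sub (hpi.mul_const _)
  refine le_of_eq_of_le ?_
    (integral_mono_ae (hi₁.add (integrable_const (M + 1 - v))) hint hle)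
  rw [integral_add' hi₁ (integrable_const _), integral_sub (hqi.mul_const _) (hpi.mul_const _),
    integral_mul_const, integral_mul_const, ← ha, ← hb]
  simp only [integral_const, probReal_univ, one_smul]
  linarith

/-- A Donsker–Varadhan type change of measure for a nonnegative function. -/
theorem integral_le_integral_llr_add_log {H : Type*} [MeasurableSpace H] {P Q : Measure H}
    [IsProbabilityMeasure P] [IsProbabilityMeasure Q] (hQP : Q ≪ P)
    (hllr : Integrable (llr Q P) Q) {φ : H → ℝ} (hφm : Measurable φ) (hφ : ∀ᵐ h ∂Q, 0 ≤ φ h)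
    {C : ℝ} (hC : 0 < C)
    (hexp : ∫⁻ h, ENNReal.ofReal (Real.exp (φ h)) ∂P ≤ ENNReal.ofReal C) :
    Integrable φ Q ∧ ∫ h, φ h ∂Q ≤ ∫ h, llr Q P h ∂Q + Real.log C := by
  have hlm := measurable_llr Q P
  have hlint : ∫⁻ h, ENNReal.ofReal (Real.exp (φ h - llr Q P h)) ∂Q ≤ ENNReal.ofReal C := by
    refine le_trans ?_ hexp
    rw [← lintegral_rnDeriv_mul hQP (by fun_prop)]
    refine lintegral_mono_ae ?_
    filter_upwards [exp_llr Q P, Q.rnDeriv_lt_top P] with h hh htop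
    by_cases hz : Q.rnDeriv P h = 0
    · simp [hz]
    · rw [if_neg hz] at hh
      refine le_of_eq ?_
      rw [Real.exp_sub, hh, ← ENNReal.ofReal_toReal htop.ne,
        ← ENNReal.ofReal_mul ENNReal.toReal_nonneg, ENNReal.toReal_ofReal ENNReal.toReal_nonneg]
      have := (ENNReal.toReal_pos hz htop.ne).ne'
      congr 1
      field_simp
  have hei : Integrable (fun h => Real.exp (φ h - llr Q P h)) Q :=
    ⟨by fun_prop, (hasFiniteIntegral_iff_ofReal (ae_of_all _ fun h => (Real.exp_pos _).le)).2
      (hlint.trans_lt ENNReal.ofReal_lt_top)⟩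
  have hele : ∫ h, Real.exp (φ h - llr Q P h) ∂Q ≤ C := by
    rw [integral_eq_lintegral_of_nonneg_ae (ae_of_all _ fun h => (Real.exp_pos _).le)
      hei.aestronglyMeasurable]
    exact ENNReal.toReal_le_of_le_ofReal hC.le hlint
  have hi₁ : Integrable (fun h => llr Q P h + Real.exp (φ h - llr Q P h) / C) Q :=
    hllr.add (hei.div_const C)
  have hbd : ∀ h, φ h ≤ llr Q P h + Real.exp (φ h - llr Q P h) / C + (Real.log C - 1) := by
    intro h
    have := Real.add_one_le_exp (φ h - llr Q P h - Real.log C)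
    rw [Real.exp_sub _ (Real.log C), Real.exp_log hC] at this
    linarith
  have hbi := hi₁.add (integrable_const (Real.log C - 1))
  have hφi : Integrable φ Q := by
    refine hbi.mono' hφm.aestronglyMeasurable ?_
    filter_upwards [hφ] with h hh
    rw [Real.norm_of_nonneg hh]
    exact hbd h
  refine ⟨hφi, (integral_mono hφi hbi hbd).trans ?_⟩
  rw [integral_add' hi₁ (integrable_const _), integral_add hllr (hei.div_const C),
    integral_div]
  simp only [integral_const, probReal_univ, one_smul]
  have : (∫ h, Real.exp (φ h - llr Q P h) ∂Q) / C ≤ 1 := (div_le_one hC).2 hele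
  linarith

/-- The exponential moment `exp (c * kl(q, p))`, infinite where `kl(q, p)` is. -/
noncomputable def expKl (c q p : ℝ) : ℝ≥0∞ :=
  if (p = 0 ∧ q ≠ 0) ∨ (p = 1 ∧ q ≠ 1) then ∞ else ENNReal.ofReal (Real.exp (c * klReal q p))

theorem Measurable.klReal {α : Type*} [MeasurableSpace α] {q p : α → ℝ} (hq : Measurable q)
    (hp : Measurable p) : Measurable fun x => klReal (q x) (p x) := by
  unfold _root_.klReal
  fun_prop

theorem Measurable.expKl {α : Type*} [MeasurableSpace α] {q p : α → ℝ} (hq : Measurable q)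
    (hp : Measurable p) (c : ℝ) : Measurable fun x => expKl c (q x) (p x) := by
  unfold _root_.expKl
  refine Measurable.ite ?_ measurable_const
    ((hq.klReal hp).const_mul c).exp.ennreal_ofReal
  have h (f : α → ℝ) (hf : Measurable f) (a : ℝ) : MeasurableSet {x | f x = a} :=
    hf (measurableSet_singleton a)
  exact ((h p hp 0).inter (h q hq 0).compl).union ((h p hp 1).inter (h q hq 1).compl)

/-- Maurer's bound on the exponential moment of the binary relative entropy. -/
theorem lintegral_expKl_le {Z : Type*} [MeasurableSpace Z] (D : Measure Z)
    [IsProbabilityMeasure D] {g : Z → ℝ} (hg : Measurable g) (hg01 : ∀ z, g z ∈ Set.Icc (0 : ℝ) 1)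
    {m : ℕ} (hm : 1 ≤ m) :
    ∫⁻ S, expKl m (1 / (m : ℝ) * ∑ j, g (S j)) (∫ z, g z ∂D) ∂(Measure.pi fun _ : Fin m => D) ≤
      ENNReal.ofReal (2 * √m) := by
  have hgint : Integrable g D := Integrable.of_mem_Icc 0 1 hg.aemeasurable (ae_of_all _ hg01)
  have hm1 : (1 : ℝ) ≤ m := by exact_mod_cast hm
  have hm0 : (m : ℝ) ≠ 0 := by positivity
  have hconst : ∀ c : ℝ, ∫ z, g z ∂D = c → (c = 0 ∨ c = 1) → (∀ᵐ z ∂D, g z = c) →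
      ∫⁻ S, expKl m (1 / (m : ℝ) * ∑ j, g (S j)) (∫ z, g z ∂D)
        ∂(Measure.pi fun _ : Fin m => D) ≤ ENNReal.ofReal (2 * √m) := by
    intro c hc hc01 hae
    have hall : ∀ᵐ S ∂(Measure.pi fun _ : Fin m => D), ∀ j, g (S j) = c :=
      ae_all_iff.2 fun j =>
      (Measure.quasiMeasurePreserving_eval (fun _ : Fin m => D) j).ae hae
    have h1 : ∀ᵐ S ∂(Measure.pi fun _ : Fin m => D),
        expKl m (1 / (m : ℝ) * ∑ j, g (S j)) (∫ z, g z ∂D) = 1 := by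
      filter_upwards [hall] with S hS
      have hmean : 1 / (m : ℝ) * ∑ j, g (S j) = c := by
        simp only [hS, Finset.sum_const, Finset.card_univ, Fintype.card_fin, nsmul_eq_mul]
        field_simp
      rw [hmean, hc]
      rcases hc01 with rfl | rfl <;> simp [expKl, klReal]
    rw [lintegral_congr_ae h1]
    have hr1 : 1 ≤ √(m : ℝ) := Real.one_le_sqrt.2 hm1
    simp only [lintegral_const, measure_univ, mul_one]
    rw [← ENNReal.ofReal_one]
    exact ENNReal.ofReal_le_ofReal (by linarith)
  have hcompl : ∫ z, (1 - g z) ∂D = 1 - ∫ z, g z ∂D := by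
    rw [integral_sub (integrable_const _) hgint]
    simp
  have hp0 : 0 ≤ ∫ z, g z ∂D := integral_nonneg fun z => (hg01 z).1
  have hp1 : 0 ≤ 1 - ∫ z, g z ∂D := by
    rw [← hcompl]
    exact integral_nonneg fun z => sub_nonneg.2 (hg01 z).2
  by_cases h0 : ∫ z, g z ∂D = 0
  · exact hconst 0 h0 (Or.inl rfl)
      ((integral_eq_zero_iff_of_nonneg (fun z => (hg01 z).1) hgint).1 h0)
  by_cases h1 : ∫ z, g z ∂D = 1
  · refine hconst 1 h1 (Or.inr rfl) ?_
    filter_upwards [(integral_eq_zero_iff_of_nonneg (fun z => sub_nonneg.2 (hg01 z).2)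
      ((integrable_const _).sub hgint)).1 (by rw [hcompl, h1, sub_self])] with z hz
    have : 1 - g z = 0 := hz
    linarith
  · simp only [expKl, h0, h1, false_and, or_self, if_false]
    exact lintegral_exp_klReal_le D hg hg01 hm
      ⟨hp0.lt_of_ne' h0, (sub_nonneg.1 hp1).lt_of_ne h1⟩

theorem klBin_le_of_lintegral_expKl_le {H : Type*} [MeasurableSpace H] (P : Measure H)
    [IsProbabilityMeasure P] {q p : H → ℝ} (hqm : Measurable q) (hpm : Measurable p)
    (hq : ∀ h, q h ∈ Set.Icc (0 : ℝ) 1) (hp : ∀ h, p h ∈ Set.Icc (0 : ℝ) 1) {m : ℕ} (hm : 1 ≤ m)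
    {C : ℝ} (hC : 1 ≤ C) (hexp : ∫⁻ h, expKl m (q h) (p h) ∂P ≤ ENNReal.ofReal C)
    (Q : Measure H) [IsProbabilityMeasure Q] :
    klBin (∫ h, q h ∂Q) (∫ h, p h ∂Q) ≤
      (klDiv' Q P + ENNReal.ofReal (Real.log C)) / (m : ℝ≥0∞) := by
  have hm0 : (0 : ℝ) < m := by exact_mod_cast hm
  unfold klDiv'
  split_ifs with hac
  swap
  · simp [ENNReal.top_div]
  obtain ⟨hQP, hllr⟩ := hac
  have hgood : ∀ᵐ h ∂Q, ¬((p h = 0 ∧ q h ≠ 0) ∨ (p h = 1 ∧ q h ≠ 1)) := by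
    refine hQP.ae_le ?_
    filter_upwards [ae_lt_top (hqm.expKl hpm m) (hexp.trans_lt ENNReal.ofReal_lt_top).ne]
      with h hh hbad
    rw [expKl, if_pos hbad] at hh
    exact lt_irrefl _ hh
  have h0 : ∀ᵐ h ∂Q, p h = 0 → q h = 0 := by
    filter_upwards [hgood] with h hh hp0
    by_contra hne
    exact hh (Or.inl ⟨hp0, hne⟩)
  have h1 : ∀ᵐ h ∂Q, p h = 1 → q h = 1 := by
    filter_upwards [hgood] with h hh hp1
    by_contra hne
    exact hh (Or.inr ⟨hp1, hne⟩)
  have hnn : ∀ᵐ h ∂Q, 0 ≤ (m : ℝ) * klReal (q h) (p h) := by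
    filter_upwards [h0, h1] with h hh0 hh1
    exact mul_nonneg hm0.le (klReal_nonneg (hq h) (hp h) hh0 hh1)
  have hexp' : ∫⁻ h, ENNReal.ofReal (Real.exp (m * klReal (q h) (p h))) ∂P ≤
      ENNReal.ofReal C := by
    refine (lintegral_mono fun h => ?_).trans hexp
    unfold expKl
    split_ifs
    · exact le_top
    · exact le_rfl
  obtain ⟨hint, hle⟩ := integral_le_integral_llr_add_log hQP hllr
    ((hqm.klReal hpm).const_mul (m : ℝ)) hnn (zero_lt_one.trans_le hC) hexp'
  have hint' : Integrable (fun h => klReal (q h) (p h)) Q := by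
    have := hint.const_mul (m : ℝ)⁻¹
    simpa [← mul_assoc, inv_mul_cancel₀ hm0.ne'] using this
  refine (klBin_integral_le Q hqm.aemeasurable hpm.aemeasurable hq hp h0 h1 hint').trans ?_
  rw [integral_const_mul] at hle
  rw [ENNReal.le_div_iff_mul_le (Or.inl (by simpa using hm0.ne')) (Or.inl (by simp)),
    ← ENNReal.ofReal_natCast, ← ENNReal.ofReal_mul' hm0.le, mul_comm]
  exact (ENNReal.ofReal_le_ofReal hle).trans ENNReal.ofReal_add_le

/-- **McAllester–Maurer PAC-Bayes bound.** With probability at least `1 − δ` over the draw of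
`S ~ D^⊗m`, simultaneously for every posterior `Q`,
`kl(R̂_S(Q), R_D(Q)) ≤ (KL(Q‖P) + ln(2√m/δ)) / m`. -/
theorem mcallester_maurer_pac_bayes
    {H Z : Type*} [MeasurableSpace H] [MeasurableSpace Z]
    (ℓ : H → Z → ℝ) (hℓmeas : Measurable fun p : H × Z => ℓ p.1 p.2)
    (hℓbdd : ∀ h z, ℓ h z ∈ Set.Icc (0 : ℝ) 1)
    (D : Measure Z) [IsProbabilityMeasure D]
    (m : ℕ) (hm : 1 ≤ m)
    (P : Measure H) [IsProbabilityMeasure P]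
    (δ : ℝ) (hδ : δ ∈ Set.Ioo (0 : ℝ) 1) :
    ENNReal.ofReal (1 - δ) ≤
      (Measure.pi fun _ : Fin m => D)
        {S | ∀ Q : Measure H, IsProbabilityMeasure Q →
          klBin (riskSQ ℓ S Q) (riskDQ ℓ D Q) ≤
            (klDiv' Q P + ENNReal.ofReal (Real.log (2 * Real.sqrt m / δ))) / (m : ℝ≥0∞)} := by
  have hm1 : (1 : ℝ) ≤ m := by exact_mod_cast hm
  have hm0 : (0 : ℝ) < m := zero_lt_one.trans_le hm1
  have hr1 : 1 ≤ √(m : ℝ) := Real.one_le_sqrt.2 hm1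
  have hC : 1 ≤ 2 * √(m : ℝ) / δ := by
    rw [le_div_iff₀ hδ.1]
    linarith [hδ.2]
  have hDm : Measurable (riskD ℓ D) :=
    hℓmeas.stronglyMeasurable.integral_prod_right.measurable
  have hℓh : ∀ h, Measurable (ℓ h) := fun h => hℓmeas.comp measurable_prodMk_left
  have hSm : Measurable fun x : (Fin m → Z) × H => riskS ℓ x.1 x.2 := by
    unfold riskS
    refine (Finset.measurable_sum _ fun j _ => ?_).const_mul _
    exact hℓmeas.comp (measurable_snd.prodMk ((measurable_pi_apply j).comp measurable_fst))
  have hD01 : ∀ h, riskD ℓ D h ∈ Set.Icc (0 : ℝ) 1 := fun h => by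
    refine ⟨integral_nonneg fun z => (hℓbdd h z).1, ?_⟩
    have hi : Integrable (ℓ h) D :=
      Integrable.of_mem_Icc 0 1 (hℓh h).aemeasurable (ae_of_all _ (hℓbdd h))
    simpa [riskD] using integral_mono hi (integrable_const 1) fun z => (hℓbdd h z).2
  have hS01 : ∀ (S : Fin m → Z) h, riskS ℓ S h ∈ Set.Icc (0 : ℝ) 1 := fun S h => by
    refine ⟨mul_nonneg (by positivity) (Finset.sum_nonneg fun j _ => (hℓbdd h _).1), ?_⟩
    have hs : ∑ j, ℓ h (S j) ≤ m := by
      simpa using Finset.sum_le_card_nsmul Finset.univ (fun j => ℓ h (S j)) 1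
        fun j _ => (hℓbdd h _).2
    rw [riskS, one_div_mul_eq_div]
    exact div_le_one_of_le₀ hs hm0.le
  have hGm : Measurable fun x : (Fin m → Z) × H => expKl m (riskS ℓ x.1 x.2) (riskD ℓ D x.2) :=
    hSm.expKl (hDm.comp measurable_snd) m
  set μ := Measure.pi fun _ : Fin m => D
  set F : (Fin m → Z) → ℝ≥0∞ := fun S => ∫⁻ h, expKl m (riskS ℓ S h) (riskD ℓ D h) ∂P
  have hFm : Measurable F := hGm.lintegral_prod_right'
  have hF : ∫⁻ S, F S ∂μ ≤ ENNReal.ofReal (2 * √m) := by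
    rw [lintegral_lintegral_swap hGm.aemeasurable]
    refine (lintegral_mono fun h => lintegral_expKl_le D (hℓh h) (hℓbdd h) hm).trans ?_
    simp
  have hmarkov : μ {S | ENNReal.ofReal (2 * √m / δ) ≤ F S} ≤ ENNReal.ofReal δ := by
    have hC0 : 0 < 2 * √(m : ℝ) / δ := zero_lt_one.trans_le hC
    refine (meas_ge_le_lintegral_div hFm.aemeasurable
      (ENNReal.ofReal_pos.2 hC0).ne' ENNReal.ofReal_ne_top).trans ?_
    refine (ENNReal.div_le_div_right hF _).trans_eq ?_
    rw [← ENNReal.ofReal_div_of_pos hC0]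
    have := hδ.1.ne'
    congr 1
    field_simp
  have hmeas : MeasurableSet {S | ENNReal.ofReal (2 * √m / δ) ≤ F S} :=
    measurableSet_le measurable_const hFm
  calc ENNReal.ofReal (1 - δ) = 1 - ENNReal.ofReal δ := by
        rw [ENNReal.ofReal_sub _ hδ.1.le, ENNReal.ofReal_one]
    _ ≤ 1 - μ {S | ENNReal.ofReal (2 * √m / δ) ≤ F S} := tsub_le_tsub_left hmarkov 1
    _ = μ {S | ENNReal.ofReal (2 * √m / δ) ≤ F S}ᶜ := (prob_compl_eq_one_sub hmeas).symm
    _ ≤ _ := measure_mono ?_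
  intro S hS Q hQ
  have hS' : F S ≤ ENNReal.ofReal (2 * √m / δ) := by
    rw [Set.mem_compl_iff, Set.mem_ofPred_eq, not_le] at hS
    exact hS.le
  exact klBin_le_of_lintegral_expKl_le P (hSm.comp measurable_prodMk_left) hDm (hS01 S) hD01 hm
    hC hS' Q
end

section
/- Fix a probability measure D on Z, an integer m ≥ 1, a prior probability measure P on H, and δ ∈ (0,1). With probability at least 1−δ over the draw of an i.i.d. sample S ~ D^⊗m, simultaneously for every probability measure Q on H, R_D(Q) ≤ R̂_S(Q) + √( (KL(Q‖P) + ln(2√m/δ)) / (2m) ) (Pinsker relaxation of McAllester's bound). -/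
open MeasureTheory ENNReal

open ProbabilityTheory in
/-- Hoeffding's exponential moment bound for the empirical mean of a `[0, 1]`-valued function. -/
lemma lintegral_exp_mul_mean_sub_empirical_le_one {Z : Type*} [MeasurableSpace Z]
    (D : Measure Z) [IsProbabilityMeasure D] {m : ℕ} (hm : 1 ≤ m) {g : Z → ℝ}
    (hg : Measurable g) (hb : ∀ z, g z ∈ Set.Icc (0 : ℝ) 1) (t : ℝ) :
    ∫⁻ S : Fin m → Z, ENNReal.ofReal (Real.exp
      (t * (∫ z, g z ∂D - 1 / (m : ℝ) * ∑ j, g (S j)) - t ^ 2 / (8 * m)))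
      ∂(Measure.pi fun _ => D) ≤ 1 := by
  have hm0 : (0 : ℝ) < m := by exact_mod_cast hm
  have hsub : HasSubgaussianMGF (fun z ↦ g z - ∫ z, g z ∂D) ((‖(1 : ℝ) - 0‖₊ / 2) ^ 2) D :=
    hasSubgaussianMGF_of_mem_Icc hg.aemeasurable (ae_of_all _ hb)
  have hind : iIndepFun (fun (i : Fin m) (S : Fin m → Z) ↦ g (S i) - ∫ z, g z ∂D)
      (Measure.pi fun _ => D) :=
    iIndepFun_pi (X := fun _ z ↦ g z - ∫ z, g z ∂D) fun _ ↦ (hg.sub_const _).aemeasurable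
  have hsum := HasSubgaussianMGF.sum_of_iIndepFun hind (s := Finset.univ)
    (c := fun _ ↦ (‖(1 : ℝ) - 0‖₊ / 2) ^ 2) fun i _ ↦ by
      have hmp := measurePreserving_eval (fun _ : Fin m ↦ D) i
      exact HasSubgaussianMGF.of_map (X := fun z ↦ g z - ∫ z, g z ∂D) (Y := Function.eval i)
        hmp.measurable.aemeasurable (by rwa [hmp.map_eq])
  have hexp (S : Fin m → Z) : Real.exp
      (t * (∫ z, g z ∂D - 1 / (m : ℝ) * ∑ j, g (S j)) - t ^ 2 / (8 * m)) =
      Real.exp (-(t ^ 2 / (8 * m))) *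
        Real.exp (-(t / m) * ∑ j, (g (S j) - ∫ z, g z ∂D)) := by
    rw [← Real.exp_add, Finset.sum_sub_distrib]
    congr 1
    simp only [Finset.sum_const, Finset.card_univ, Fintype.card_fin, nsmul_eq_mul]
    field_simp
    ring
  simp_rw [hexp]
  rw [← ofReal_integral_eq_lintegral_ofReal ((hsum.integrable_exp_mul _).const_mul _)
    (ae_of_all _ fun _ ↦ by positivity), integral_const_mul, ENNReal.ofReal_le_one]
  calc _ ≤ Real.exp (-(t ^ 2 / (8 * m))) * Real.exp (t ^ 2 / (8 * m)) := by
        gcongr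
        refine (hsum.mgf_le (-(t / m))).trans_eq ?_
        congr 1
        simp
        field_simp
        norm_num
        ring
    _ = 1 := by rw [← Real.exp_add]; simp

/-- The Donsker–Varadhan inequality. -/
lemma exp_integral_sub_integral_llr_le {α : Type*} [MeasurableSpace α] {Q P : Measure α}
    [IsProbabilityMeasure Q] [IsProbabilityMeasure P] (hQP : Q ≪ P)
    (hllr : Integrable (llr Q P) Q) {f : α → ℝ} (hfQ : Integrable f Q)
    (hfP : Integrable (fun x ↦ Real.exp (f x)) P) :
    Real.exp (∫ x, f x ∂Q - ∫ x, llr Q P x ∂Q) ≤ ∫ x, Real.exp (f x) ∂P := by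
  have := isProbabilityMeasure_tilted hfP
  have h := InformationTheory.integral_llr_add_sub_measure_univ_nonneg
    (hQP.trans (absolutelyContinuous_tilted hfP)) (integrable_llr_tilted_right hQP hfQ hllr hfP)
  rw [integral_llr_tilted_right hQP hfQ hfP hllr] at h
  simp only [probReal_univ] at h
  rw [← Real.le_log_iff_exp_le (integral_exp_pos hfP)]
  linarith

lemma half_mul_five_thirds_sub_le_exp_neg (y : ℝ) :
    1 / 2 * (5 / 3 - y) ≤ Real.exp (-y) := by
  have h1 : Real.exp (-y) = Real.exp (-(2 / 3)) * Real.exp (2 / 3 - y) := by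
    rw [← Real.exp_add]; ring_nf
  have h2 : 2 / 3 - y + 1 ≤ Real.exp (2 / 3 - y) := Real.add_one_le_exp _
  have h3 : (1 / 2 : ℝ) ≤ Real.exp (-(2 / 3)) := by
    have h4 : Real.exp (-(2 / 3)) ^ 3 = (Real.exp 1 ^ 2)⁻¹ := by
      rw [← Real.exp_nat_mul, ← Real.exp_nat_mul, ← Real.exp_neg]; norm_num
    refine le_of_pow_le_pow_left₀ three_ne_zero (Real.exp_pos _).le ?_
    rw [h4, one_div, inv_pow]
    refine inv_anti₀ (by positivity) ?_
    nlinarith [Real.exp_one_lt_d9, Real.exp_pos 1]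
  calc 1 / 2 * (5 / 3 - y) ≤ 1 / 2 * Real.exp (2 / 3 - y) := by linarith
    _ ≤ _ := by rw [h1]; gcongr

/-- Averaging sub-Gaussian exponential weights over `λ ∈ [0, 4n]` loses at most a factor
`2 √n` compared with the optimal `λ = 4 n x`. -/
lemma two_sqrt_mul_exp_le_integral {n x : ℝ} (hn : 1 ≤ n) (hx : x ∈ Set.Icc (0 : ℝ) 1) :
    2 * √n * Real.exp (2 * n * x ^ 2) ≤
      ∫ t in (0 : ℝ)..4 * n, Real.exp (t * x - t ^ 2 / (8 * n)) := by
  obtain ⟨s, hs, rfl⟩ : ∃ s : ℝ, 1 ≤ s ∧ n = s ^ 2 :=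
    ⟨√n, Real.one_le_sqrt.2 hn, (Real.sq_sqrt (by linarith)).symm⟩
  obtain ⟨hx0, hx1⟩ := hx
  have hs0 : 0 < s := by linarith
  rw [Real.sqrt_sq hs0.le]
  set c := 4 * s ^ 2 * x with hc
  have ha : 0 ≤ c - 4 * s * x := by
    have : 0 ≤ s * x * (s - 1) := by have := sub_nonneg.2 hs; positivity
    nlinarith
  have hb : c + 4 * s * (1 - x) ≤ 4 * s ^ 2 := by
    have : 0 ≤ s * (1 - x) * (s - 1) := by
      have := sub_nonneg.2 hs; have := sub_nonneg.2 hx1; positivity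
    nlinarith
  have hab : c - 4 * s * x ≤ c + 4 * s * (1 - x) := by nlinarith
  have hcont : Continuous fun t : ℝ ↦ Real.exp (t * x - t ^ 2 / (8 * s ^ 2)) := by fun_prop
  calc 2 * s * Real.exp (2 * s ^ 2 * x ^ 2)
      ≤ ∫ t in (c - 4 * s * x)..(c + 4 * s * (1 - x)), Real.exp (2 * s ^ 2 * x ^ 2) *
          (1 / 2 * (5 / 3 - (t - c) ^ 2 / (8 * s ^ 2))) := by
        rw [intervalIntegral.integral_const_mul, intervalIntegral.integral_const_mul,
          intervalIntegral.integral_comp_sub_right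
            (fun u ↦ 5 / 3 - u ^ 2 / (8 * s ^ 2)) c,
          intervalIntegral.integral_sub (by simp) (by
            apply Continuous.intervalIntegrable; fun_prop),
          intervalIntegral.integral_const, intervalIntegral.integral_div, integral_pow,
          mul_comm (2 * s)]
        refine mul_le_mul_of_nonneg_left ?_ (Real.exp_pos _).le
        have := mul_nonneg hs0.le (mul_nonneg hx0 (sub_nonneg.2 hx1))
        calc 2 * s ≤ 2 * s + 4 * (s * (x * (1 - x))) := by linarith
          _ = _ := by
            rw [smul_eq_mul]
            push_cast
            field_simp
            ring
    _ ≤ ∫ t in (c - 4 * s * x)..(c + 4 * s * (1 - x)),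
          Real.exp (t * x - t ^ 2 / (8 * s ^ 2)) := by
        refine intervalIntegral.integral_mono_on hab
          (Continuous.intervalIntegrable (by fun_prop) _ _) (hcont.intervalIntegrable _ _) ?_
        intro t _
        have : Real.exp (t * x - t ^ 2 / (8 * s ^ 2)) =
            Real.exp (2 * s ^ 2 * x ^ 2) * Real.exp (-((t - c) ^ 2 / (8 * s ^ 2))) := by
          rw [← Real.exp_add, hc]
          congr 1
          field_simp
          ring
        rw [this]
        gcongr
        exact half_mul_five_thirds_sub_le_exp_neg _
    _ ≤ ∫ t in (0 : ℝ)..4 * s ^ 2, Real.exp (t * x - t ^ 2 / (8 * s ^ 2)) :=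
        intervalIntegral.integral_mono_interval ha hab hb
          (ae_of_all _ fun _ ↦ (Real.exp_pos _).le) (hcont.intervalIntegrable _ _)

/-- Exponential weights for the risk gap, mixed over the prior `P` and `t ∈ (0, 4m]`. -/
noncomputable def mixedExpGap {H Z : Type*} [MeasurableSpace H] [MeasurableSpace Z]
    (ℓ : H → Z → ℝ) (D : Measure Z) (P : Measure H) {m : ℕ} (S : Fin m → Z) : ℝ≥0∞ :=
  ∫⁻ t in Set.Ioc (0 : ℝ) (4 * m), ∫⁻ h, ENNReal.ofReal
    (Real.exp (t * (riskD ℓ D h - riskS ℓ S h) - t ^ 2 / (8 * m))) ∂P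

lemma riskD_mem_Icc {H Z : Type*} [MeasurableSpace Z] {ℓ : H → Z → ℝ}
    (hb : ∀ h z, ℓ h z ∈ Set.Icc (0 : ℝ) 1) (D : Measure Z)
    [IsProbabilityMeasure D] (h : H) : riskD ℓ D h ∈ Set.Icc (0 : ℝ) 1 := by
  refine ⟨integral_nonneg fun z ↦ (hb h z).1, ?_⟩
  have := integral_mono_of_nonneg (μ := D) (ae_of_all _ fun z ↦ (hb h z).1)
    (integrable_const (1 : ℝ)) (ae_of_all _ fun z ↦ (hb h z).2)
  simpa [riskD] using this

lemma riskS_mem_Icc {H Z : Type*} {ℓ : H → Z → ℝ}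
    (hb : ∀ h z, ℓ h z ∈ Set.Icc (0 : ℝ) 1) {m : ℕ} (S : Fin m → Z) (h : H) :
    riskS ℓ S h ∈ Set.Icc (0 : ℝ) 1 := by
  refine ⟨mul_nonneg (by positivity) (Finset.sum_nonneg fun j _ ↦ (hb h (S j)).1), ?_⟩
  have := Finset.sum_le_card_nsmul Finset.univ (fun j ↦ ℓ h (S j)) 1 fun j _ ↦ (hb h (S j)).2
  simp only [Finset.card_univ, Fintype.card_fin, nsmul_eq_mul, mul_one] at this
  rw [riskS, one_div_mul_eq_div]
  exact div_le_one_of_le₀ this (by positivity)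

section

variable {H Z : Type*} [MeasurableSpace H] [MeasurableSpace Z] {ℓ : H → Z → ℝ}

lemma measurable_riskD (hℓ : Measurable fun p : H × Z => ℓ p.1 p.2) (D : Measure Z)
    [IsProbabilityMeasure D] : Measurable (riskD ℓ D) :=
  (hℓ.stronglyMeasurable.integral_prod_right (ν := D)).measurable

lemma measurable_riskS_uncurry (hℓ : Measurable fun p : H × Z => ℓ p.1 p.2) {m : ℕ} :
    Measurable fun p : (Fin m → Z) × H => riskS ℓ p.1 p.2 := by
  unfold riskS
  refine Measurable.const_mul (Finset.measurable_sum _ fun j _ ↦ ?_) _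
  exact hℓ.comp (measurable_snd.prodMk ((measurable_pi_apply j).comp measurable_fst))

lemma measurable_expGap (hℓ : Measurable fun p : H × Z => ℓ p.1 p.2) (D : Measure Z)
    [IsProbabilityMeasure D] {m : ℕ} :
    Measurable fun p : ((Fin m → Z) × ℝ) × H => ENNReal.ofReal (Real.exp
      (p.1.2 * (riskD ℓ D p.2 - riskS ℓ p.1.1 p.2) - p.1.2 ^ 2 / (8 * m))) := by
  have h1 : Measurable fun p : ((Fin m → Z) × ℝ) × H => riskD ℓ D p.2 :=
    (measurable_riskD hℓ D).comp measurable_snd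
  have h2 : Measurable fun p : ((Fin m → Z) × ℝ) × H => riskS ℓ p.1.1 p.2 :=
    (measurable_riskS_uncurry hℓ).comp (measurable_fst.fst.prodMk measurable_snd)
  have h3 : Measurable fun p : ((Fin m → Z) × ℝ) × H => p.1.2 := by fun_prop
  exact (((h3.mul (h1.sub h2)).sub ((h3.pow_const 2).div_const _)).exp).ennreal_ofReal

lemma measurable_mixedExpGap (hℓ : Measurable fun p : H × Z => ℓ p.1 p.2) (D : Measure Z)
    [IsProbabilityMeasure D] (P : Measure H) [IsProbabilityMeasure P] {m : ℕ} :
    Measurable fun S : Fin m → Z => mixedExpGap ℓ D P S :=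
  (measurable_expGap hℓ D).lintegral_prod_right'.lintegral_prod_right'

lemma lintegral_mixedExpGap_le (hℓ : Measurable fun p : H × Z => ℓ p.1 p.2)
    (hb : ∀ h z, ℓ h z ∈ Set.Icc (0 : ℝ) 1) (D : Measure Z) [IsProbabilityMeasure D]
    (P : Measure H) [IsProbabilityMeasure P] {m : ℕ} (hm : 1 ≤ m) :
    ∫⁻ S : Fin m → Z, mixedExpGap ℓ D P S ∂(Measure.pi fun _ => D) ≤
      ENNReal.ofReal (4 * m) := by
  have hmeas := measurable_expGap hℓ D (m := m)
  unfold mixedExpGap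
  rw [lintegral_lintegral_swap hmeas.lintegral_prod_right'.aemeasurable]
  calc _ ≤ ∫⁻ _ in Set.Ioc (0 : ℝ) (4 * m), 1 := by
        refine lintegral_mono fun t ↦ ?_
        have ht : Measurable fun p : (Fin m → Z) × H => ((p.1, t), p.2) :=
          (measurable_fst.prodMk measurable_const).prodMk measurable_snd
        dsimp only
        rw [lintegral_lintegral_swap (f := fun S h ↦ ENNReal.ofReal (Real.exp
          (t * (riskD ℓ D h - riskS ℓ S h) - t ^ 2 / (8 * m)))) (hmeas.comp ht).aemeasurable]
        calc _ ≤ ∫⁻ _, 1 ∂P := lintegral_mono fun h ↦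
              lintegral_exp_mul_mean_sub_empirical_le_one D hm
                (hℓ.comp measurable_prodMk_left) (hb h) t
          _ = 1 := by simp
    _ = _ := by simp

/-- On samples where the mixed exponential weights are small, the risk gap of every posterior
is controlled by its divergence from the prior. -/
lemma two_mul_sq_gap_le_of_mixedExpGap_lt (hℓ : Measurable fun p : H × Z => ℓ p.1 p.2)
    (hb : ∀ h z, ℓ h z ∈ Set.Icc (0 : ℝ) 1) (D : Measure Z) [IsProbabilityMeasure D]
    (P : Measure H) [IsProbabilityMeasure P] {m : ℕ} (hm : 1 ≤ m) {δ : ℝ} (hδ : 0 < δ)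
    {S : Fin m → Z} (hS : mixedExpGap ℓ D P S < ENNReal.ofReal (4 * m / δ))
    {Q : Measure H} [IsProbabilityMeasure Q] (hQP : Q ≪ P) (hllr : Integrable (llr Q P) Q)
    (hx : 0 ≤ riskDQ ℓ D Q - riskSQ ℓ S Q) :
    2 * m * (riskDQ ℓ D Q - riskSQ ℓ S Q) ^ 2 ≤
      ∫ h, llr Q P h ∂Q + Real.log (2 * √m / δ) := by
  have hm1 : (1 : ℝ) ≤ m := by exact_mod_cast hm
  have hmD := measurable_riskD hℓ D
  have hmS : Measurable (riskS ℓ S) := (measurable_riskS_uncurry hℓ).comp measurable_prodMk_left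
  have hiD : Integrable (riskD ℓ D) Q :=
    Integrable.of_mem_Icc 0 1 hmD.aemeasurable (ae_of_all _ (riskD_mem_Icc hb D))
  have hiS : Integrable (riskS ℓ S) Q :=
    Integrable.of_mem_Icc 0 1 hmS.aemeasurable (ae_of_all _ (riskS_mem_Icc hb S))
  have hx1 : riskDQ ℓ D Q - riskSQ ℓ S Q ≤ 1 := by
    have h1 : riskDQ ℓ D Q ≤ 1 := by
      have := integral_mono hiD (integrable_const 1) fun h ↦ (riskD_mem_Icc hb D h).2
      simpa [riskDQ] using this
    have h2 : 0 ≤ riskSQ ℓ S Q := integral_nonneg fun h ↦ (riskS_mem_Icc hb S h).1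
    linarith
  set x := riskDQ ℓ D Q - riskSQ ℓ S Q with hxdef
  set K := ∫ h, llr Q P h ∂Q
  have hDV (t : ℝ) : ENNReal.ofReal (Real.exp (-K) * Real.exp (t * x - t ^ 2 / (8 * m))) ≤
      ∫⁻ h, ENNReal.ofReal
        (Real.exp (t * (riskD ℓ D h - riskS ℓ S h) - t ^ 2 / (8 * m))) ∂P := by
    have hiP : Integrable (fun h ↦
        Real.exp (t * (riskD ℓ D h - riskS ℓ S h) - t ^ 2 / (8 * m))) P := by
      refine Integrable.of_mem_Icc 0 (Real.exp |t|) (by fun_prop) (ae_of_all _ fun h ↦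
        ⟨(Real.exp_pos _).le, Real.exp_le_exp.2 ?_⟩)
      have h1 := riskD_mem_Icc hb D h
      have h2 := riskS_mem_Icc hb S h
      have h3 : |riskD ℓ D h - riskS ℓ S h| ≤ 1 :=
        abs_le.2 ⟨by linarith [h1.1, h2.2], by linarith [h1.2, h2.1]⟩
      have h4 : t * (riskD ℓ D h - riskS ℓ S h) ≤ |t| := by
        calc _ ≤ |t| * |riskD ℓ D h - riskS ℓ S h| := by rw [← abs_mul]; exact le_abs_self _
          _ ≤ |t| := mul_le_of_le_one_right (abs_nonneg _) h3
      have : 0 ≤ t ^ 2 / (8 * (m : ℝ)) := by positivity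
      linarith
    rw [← ofReal_integral_eq_lintegral_ofReal hiP (ae_of_all _ fun _ ↦ (Real.exp_pos _).le)]
    refine ENNReal.ofReal_le_ofReal ?_
    have hiQ : Integrable (fun h ↦ t * (riskD ℓ D h - riskS ℓ S h)) Q :=
      (hiD.sub hiS).const_mul t
    refine le_trans (le_of_eq ?_) (exp_integral_sub_integral_llr_le hQP hllr
      (hiQ.sub (integrable_const (t ^ 2 / (8 * (m : ℝ))))) hiP)
    rw [← Real.exp_add]
    congr 1
    rw [integral_sub hiQ (integrable_const _), integral_const_mul, integral_sub hiD hiS]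
    simp only [integral_const, probReal_univ, one_smul, hxdef, riskDQ, riskSQ, K]
    ring
  have hlt : ENNReal.ofReal (Real.exp (-K) * (2 * √m * Real.exp (2 * m * x ^ 2))) <
      ENNReal.ofReal (4 * m / δ) := by
    refine lt_of_le_of_lt ?_ hS
    calc _ ≤ ENNReal.ofReal (∫ t in Set.Ioc (0 : ℝ) (4 * m),
            Real.exp (-K) * Real.exp (t * x - t ^ 2 / (8 * m))) := by
          rw [integral_const_mul, ← intervalIntegral.integral_of_le (by positivity)]
          gcongr
          exact two_sqrt_mul_exp_le_integral hm1 ⟨hx, hx1⟩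
      _ = ∫⁻ t in Set.Ioc (0 : ℝ) (4 * m),
            ENNReal.ofReal (Real.exp (-K) * Real.exp (t * x - t ^ 2 / (8 * m))) := by
          refine ofReal_integral_eq_lintegral_ofReal ?_ (ae_of_all _ fun _ ↦ by positivity)
          exact Continuous.integrableOn_Ioc (by fun_prop)
      _ ≤ _ := lintegral_mono hDV
  have hreal := (ENNReal.ofReal_lt_ofReal_iff (by positivity)).1 hlt
  have hs : 0 < √(m : ℝ) := Real.sqrt_pos.2 (by linarith)
  have hexp : Real.exp (2 * m * x ^ 2 - K) ≤ 2 * √m / δ := by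
    rw [sub_eq_neg_add, Real.exp_add]
    refine le_of_mul_le_mul_left ?_ (show 0 < 2 * √(m : ℝ) by positivity)
    calc _ = Real.exp (-K) * (2 * √m * Real.exp (2 * m * x ^ 2)) := by ring
      _ ≤ 4 * m / δ := hreal.le
      _ = 4 * (√m * √m) / δ := by rw [Real.mul_self_sqrt (by positivity)]
      _ = _ := by ring
  have := (Real.le_log_iff_exp_le (by positivity)).2 hexp
  linarith

end

/-- **Pinsker relaxation of McAllester's bound.** With probability at least `1 − δ`
over `S ~ D^⊗m`, simultaneously for every posterior `Q`,
`R_D(Q) ≤ R̂_S(Q) + √((KL(Q‖P) + ln(2√m/δ)) / (2m))`. -/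
theorem mcallester_pinsker_pac_bayes
    {H Z : Type*} [MeasurableSpace H] [MeasurableSpace Z]
    (ℓ : H → Z → ℝ) (hℓmeas : Measurable fun p : H × Z => ℓ p.1 p.2)
    (hℓbdd : ∀ h z, ℓ h z ∈ Set.Icc (0 : ℝ) 1)
    (D : Measure Z) [IsProbabilityMeasure D]
    (m : ℕ) (hm : 1 ≤ m)
    (P : Measure H) [IsProbabilityMeasure P]
    (δ : ℝ) (hδ : δ ∈ Set.Ioo (0 : ℝ) 1) :
    ENNReal.ofReal (1 - δ) ≤
      (Measure.pi fun _ : Fin m => D)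
        {S | ∀ Q : Measure H, IsProbabilityMeasure Q →
          ENNReal.ofReal (riskDQ ℓ D Q) ≤
            ENNReal.ofReal (riskSQ ℓ S Q) +
              ((klDiv' Q P + ENNReal.ofReal (Real.log (2 * Real.sqrt m / δ))) /
                (2 * (m : ℝ≥0∞))) ^ (1 / 2 : ℝ)} := by
  obtain ⟨hδ0, hδ1⟩ := hδ
  have hm0 : (0 : ℝ) < m := by exact_mod_cast hm
  have hW := measurable_mixedExpGap hℓmeas D P (m := m)
  set μ := Measure.pi fun _ : Fin m => D
  have hbad : μ {S | ENNReal.ofReal (4 * m / δ) ≤ mixedExpGap ℓ D P S} ≤ ENNReal.ofReal δ := by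
    refine (meas_ge_le_lintegral_div hW.aemeasurable
      (ENNReal.ofReal_pos.2 (by positivity)).ne' ENNReal.ofReal_ne_top).trans ?_
    calc _ ≤ ENNReal.ofReal (4 * m) / ENNReal.ofReal (4 * m / δ) := by
          gcongr
          exact lintegral_mixedExpGap_le hℓmeas hℓbdd D P hm
      _ = ENNReal.ofReal δ := by
          rw [← ENNReal.ofReal_div_of_pos (by positivity)]
          congr 1
          field_simp
  calc ENNReal.ofReal (1 - δ) = 1 - ENNReal.ofReal δ := by
        rw [ENNReal.ofReal_sub _ hδ0.le, ENNReal.ofReal_one]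
    _ ≤ 1 - μ {S | ENNReal.ofReal (4 * m / δ) ≤ mixedExpGap ℓ D P S} :=
        tsub_le_tsub_left hbad 1
    _ = μ {S | ENNReal.ofReal (4 * m / δ) ≤ mixedExpGap ℓ D P S}ᶜ :=
        (prob_compl_eq_one_sub (measurableSet_le measurable_const hW)).symm
    _ ≤ _ := measure_mono ?_
  intro S hS Q _
  replace hS : mixedExpGap ℓ D P S < ENNReal.ofReal (4 * m / δ) := not_le.1 hS
  by_cases hQ : Q ≪ P ∧ Integrable (fun x => Real.log (Q.rnDeriv P x).toReal) Q
  · rw [klDiv', if_pos hQ]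
    rcases le_total (riskDQ ℓ D Q) (riskSQ ℓ S Q) with hle | hle
    · exact (ENNReal.ofReal_le_ofReal hle).trans le_self_add
    have key := two_mul_sq_gap_le_of_mixedExpGap_lt hℓmeas hℓbdd D P hm hδ0 hS hQ.1 hQ.2
      (sub_nonneg.2 hle)
    set x := riskDQ ℓ D Q - riskSQ ℓ S Q with hxdef
    have hx : 0 ≤ x := sub_nonneg.2 hle
    have h2m : (2 * (m : ℝ≥0∞)) = ENNReal.ofReal (2 * m) := by
      rw [ENNReal.ofReal_mul (by norm_num), ENNReal.ofReal_natCast, ENNReal.ofReal_ofNat]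
    calc ENNReal.ofReal (riskDQ ℓ D Q) = ENNReal.ofReal (riskSQ ℓ S Q + x) := by
          rw [hxdef]; congr 1; ring
      _ ≤ ENNReal.ofReal (riskSQ ℓ S Q) + ENNReal.ofReal x := ENNReal.ofReal_add_le
      _ ≤ _ := by
          gcongr
          rw [← ENNReal.rpow_le_rpow_iff (z := 2) (by norm_num), ← ENNReal.rpow_mul]
          norm_num
          rw [← ENNReal.ofReal_pow hx]
          refine le_trans ?_ (ENNReal.div_le_div_right ENNReal.ofReal_add_le _)
          rw [h2m, ← ENNReal.ofReal_div_of_pos (by positivity)]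
          refine ENNReal.ofReal_le_ofReal ((le_div_iff₀ (by positivity)).2 ?_)
          rw [mul_comm]
          exact key
  · rw [klDiv', if_neg hQ, top_add, ENNReal.top_div_of_ne_top (by finiteness),
      ENNReal.top_rpow_of_pos (by norm_num), add_top]
    exact le_top
end
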